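/- Let G be a countable group and let G ↷ X be an aperiodic Borel action on a standard Borel space. Then there exists S ∈ [E_G^X] such that every G-invariant ergodic Borel probability measure ν on X is S-invariant and S-ergodic, i.e., every S-invariant Borel set is ν-null or ν-conull. -/

import Mathlib

open MeasureTheory

/-- `ν` is a `G`-invariant ergodic Borel probability measure. -/
def IsErgodicInvariant (G : Type*) {X : Type*} [Group G] [MulAction G X] [MeasurableSpace X]
    (ν : Measure X) : Prop :=
  IsProbabilityMeasure ν ∧
    (∀ g : G, MeasurePreserving (fun x : X => g • x) ν ν) ∧
    ∀ s : Set X, MeasurableSet s → (∀ g : G, (fun x : X => g • x) ⁻¹' s = s) →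
      ν s = 0 ∨ ν s = 1

section

variable {G X : Type*} [Group G] [MulAction G X]

/-- A function that agrees, on each piece of a countable measurable cover, with a measurable
function is measurable. -/
theorem measurable_of_countable_cover {X Y : Type*} [MeasurableSpace X] [MeasurableSpace Y]
    {ι : Type*} [Countable ι] {f : X → Y} (A : ι → Set X) (F : ι → X → Y)
    (hA : ∀ i, MeasurableSet (A i)) (hF : ∀ i, Measurable (F i)) (hcov : ∀ x, ∃ i, x ∈ A i)
    (hf : ∀ i, ∀ x ∈ A i, f x = F i x) : Measurable f := by
  intro s hs
  have : f ⁻¹' s = ⋃ i, A i ∩ F i ⁻¹' s := by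
    ext x
    simp only [Set.mem_preimage, Set.mem_iUnion, Set.mem_inter_iff]
    constructor
    · intro hx
      obtain ⟨i, hi⟩ := hcov x
      exact ⟨i, hi, hf i x hi ▸ hx⟩
    · rintro ⟨i, hi, hx⟩
      exact (hf i x hi).symm ▸ hx
  rw [this]
  exact MeasurableSet.iUnion fun i => (hA i).inter (hF i hs)

variable [Countable G] [MeasurableSpace X] [StandardBorelSpace X]

/-- Injective Borel maps moving points within orbits preserve every invariant measure. -/
theorem measure_image_of_mem_orbit (hmeas : ∀ g : G, Measurable (fun x : X => g • x))
    {ν : Measure X} (hν : ∀ g : G, MeasurePreserving (fun x : X => g • x) ν ν)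
    {f : X → X} (hf : Measurable f) (hinj : Function.Injective f)
    (horb : ∀ x, f x ∈ MulAction.orbit G x) {s : Set X} (hs : MeasurableSet s) :
    ν (f '' s) = ν s := by
  obtain ⟨e, he⟩ := exists_surjective_nat G
  have hemb : MeasurableEmbedding f := hf.measurableEmbedding hinj
  set A : ℕ → Set X := disjointed fun i => {x | f x = e i • x} with hAdef
  have hA : ∀ i, MeasurableSet (A i) := fun i =>
    MeasurableSet.disjointed (fun i => measurableSet_eq_fun hf (hmeas (e i))) i
  have hAf : ∀ i, ∀ x ∈ A i, f x = e i • x := fun i x hx => disjointed_subset _ i hx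
  have hcov : ⋃ i, A i = Set.univ := by
    rw [hAdef, iUnion_disjointed, Set.eq_univ_iff_forall]
    intro x
    obtain ⟨g, hg⟩ := horb x
    obtain ⟨i, rfl⟩ := he g
    exact Set.mem_iUnion.2 ⟨i, hg.symm⟩
  have hdisj : Pairwise (Function.onFun Disjoint fun i => s ∩ A i) := fun i j hij =>
    (disjoint_disjointed _ hij).mono Set.inter_subset_right Set.inter_subset_right
  have hpiece : ∀ i, ν (f '' (s ∩ A i)) = ν (s ∩ A i) := by
    intro i
    have : f '' (s ∩ A i) = (fun x : X => (e i)⁻¹ • x) ⁻¹' (s ∩ A i) := by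
      ext y
      constructor
      · rintro ⟨x, hx, rfl⟩
        simpa [hAf i x hx.2] using hx
      · intro hy
        exact ⟨_, hy, by simp [hAf i _ hy.2]⟩
    rw [this, (hν _).measure_preimage (hs.inter (hA i)).nullMeasurableSet]
  have hsU : s = ⋃ i, s ∩ A i := by rw [← Set.inter_iUnion, hcov, Set.inter_univ]
  have himg : Pairwise (Function.onFun Disjoint fun i => f '' (s ∩ A i)) := fun i j hij =>
    (Set.disjoint_image_iff hinj).2 (hdisj hij)
  rw [hsU, Set.image_iUnion, measure_iUnion himg
    (fun i => hemb.measurableSet_image.2 (hs.inter (hA i))),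
    measure_iUnion hdisj (fun i => hs.inter (hA i))]
  exact tsum_congr hpiece

/-- Borel bijections moving points within orbits preserve every invariant measure. -/
theorem measurePreserving_of_mem_orbit (hmeas : ∀ g : G, Measurable (fun x : X => g • x))
    {ν : Measure X} (hν : ∀ g : G, MeasurePreserving (fun x : X => g • x) ν ν)
    {f : X → X} (hf : Measurable f) (hbij : Function.Bijective f)
    (horb : ∀ x, f x ∈ MulAction.orbit G x) : MeasurePreserving f ν ν := by
  refine ⟨hf, Measure.ext fun s hs => ?_⟩
  rw [Measure.map_apply hf hs, ← measure_image_of_mem_orbit hmeas hν hf hbij.1 horb (hf hs),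
    Set.image_preimage_eq _ hbij.2]

/-- A Borel set meeting each infinite orbit in at most one point is null for every invariant
probability measure. -/
theorem measure_eq_zero_of_partial_transversal
    (hmeas : ∀ g : G, Measurable (fun x : X => g • x))
    (haper : ∀ x : X, (MulAction.orbit G x).Infinite)
    {ν : Measure X} [IsFiniteMeasure ν]
    (hν : ∀ g : G, MeasurePreserving (fun x : X => g • x) ν ν)
    {F : Set X} (hF : MeasurableSet F)
    (huniq : ∀ x ∈ F, ∀ y ∈ F, y ∈ MulAction.orbit G x → x = y) : ν F = 0 := by
  obtain ⟨e, he⟩ := exists_surjective_nat G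
  set A : ℕ → Set X := fun i => {x | x ∈ F ∧ ∀ j < i, e j • x ≠ e i • x} with hAdef
  have hA : ∀ i, MeasurableSet (A i) := by
    intro i
    have : A i = F ∩ ⋂ j, ⋂ (_ : j < i), {x | e j • x = e i • x}ᶜ := by
      ext x; simp [hAdef]
    rw [this]
    exact hF.inter (MeasurableSet.iInter fun j => MeasurableSet.iInter fun _ =>
      (measurableSet_eq_fun (hmeas _) (hmeas _)).compl)
  set T : ℕ → Set X := fun i => (fun x : X => (e i)⁻¹ • x) ⁻¹' A i with hTdef
  have hT : ∀ i, MeasurableSet (T i) := fun i => hmeas _ (hA i)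
  have hνT : ∀ i, ν (T i) = ν (A i) := fun i =>
    (hν _).measure_preimage (hA i).nullMeasurableSet
  have key : ∀ i j, i < j → Disjoint (T i) (T j) := by
    intro i j hij
    rw [Set.disjoint_left]
    rintro y ⟨h1, -⟩ ⟨h2, h3⟩
    have h4 : (e i)⁻¹ • y = (e j)⁻¹ • y :=
      huniq _ h1 _ h2 ⟨(e j)⁻¹ * e i, by simp [mul_smul]⟩
    refine h3 i hij ?_
    simp only [← h4, smul_inv_smul]
    simp [h4]
  have hdisj : Pairwise (Function.onFun Disjoint T) := fun i j hij =>
    (lt_or_gt_of_ne hij).elim (key i j) fun h => (key j i h).symm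
  have hsum : ∑' i, ν (A i) ≠ ⊤ := by
    rw [← tsum_congr hνT, ← measure_iUnion hdisj hT]
    exact measure_ne_top _ _
  refine measure_mono_null ?_ (measure_limsup_atTop_eq_zero hsum)
  intro x hx
  rw [Filter.limsup_eq_iInf_iSup_of_nat]
  simp only [Set.iInf_eq_iInter, Set.iSup_eq_iUnion, Set.mem_iInter, Set.mem_iUnion]
  intro n
  by_contra! hcon
  refine haper x (((Set.finite_lt_nat n).image fun i => e i • x).subset ?_)
  rintro _ ⟨g, rfl⟩
  classical
  have hex : ∃ i, e i • x = g • x := by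
    obtain ⟨i, rfl⟩ := he g
    exact ⟨i, rfl⟩
  refine ⟨Nat.find hex, ?_, Nat.find_spec hex⟩
  by_contra hlt
  refine hcon (Nat.find hex) (not_lt.1 hlt) ⟨hx, fun j hj => ?_⟩
  rw [Nat.find_spec hex]
  exact Nat.find_min hex hj

end

section

variable {G X : Type*} [Group G] [MulAction G X] [MeasurableSpace X]

/-- `σ` is a Borel involution in the full group, supported on `B`, folding `B` onto `B'`: it sends
`B \ B'` into `B'`, and sends the points of `B'` it moves to `B \ B'`. -/
structure IsFold (G : Type*) {X : Type*} [Group G] [MulAction G X] [MeasurableSpace X]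
    (B B' : Set X) (σ : X → X) : Prop where
  measurable : Measurable σ
  measurableSet : MeasurableSet B'
  subset : B' ⊆ B
  involutive : Function.Involutive σ
  mem_orbit : ∀ x, σ x ∈ MulAction.orbit G x
  eq_self : ∀ x, x ∉ B → σ x = x
  mem_of_notMem : ∀ x ∈ B, x ∉ B' → σ x ∈ B'
  notMem_of_mem : ∀ x ∈ B', σ x ≠ x → σ x ∉ B'

theorem IsFold.mem {B B' : Set X} {σ : X → X} (h : IsFold G B B' σ) {x : X} (hx : x ∈ B) :
    σ x ∈ B := by
  by_contra hcon
  have := h.eq_self _ hcon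
  rw [h.involutive x] at this
  exact hcon (this ▸ hx)

/-- The points matched at stage `n` of the greedy matching as sources, when `U` is the set of
points unmatched so far. -/
def greedySource (g : ℕ → G) (P Q : ℕ → Set X) (U : Set X) (n : ℕ) : Set X :=
  (U ∩ P n) ∩ (fun x : X => g n • x) ⁻¹' (U ∩ Q n)

/-- The points matched at stage `n` of the greedy matching as targets. -/
def greedyTarget (g : ℕ → G) (P Q : ℕ → Set X) (U : Set X) (n : ℕ) : Set X :=
  (fun x : X => (g n)⁻¹ • x) ⁻¹' greedySource g P Q U n

/-- The points of `B` unmatched before stage `n` of the greedy matching. -/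
def greedyRest (g : ℕ → G) (P Q : ℕ → Set X) (B : Set X) : ℕ → Set X
  | 0 => B
  | n + 1 => greedyRest g P Q B n \ (greedySource g P Q (greedyRest g P Q B n) n ∪
      greedyTarget g P Q (greedyRest g P Q B n) n)

/-- Greedily match, at stage `n`, the still unmatched points `x ∈ P n` with `g n • x ∈ Q n`. -/
theorem exists_isFold_greedy (hmeas : ∀ g : G, Measurable (fun x : X => g • x))
    {B : Set X} (hB : MeasurableSet B) (g : ℕ → G) {P Q : ℕ → Set X}
    (hP : ∀ n, MeasurableSet (P n)) (hQ : ∀ n, MeasurableSet (Q n))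
    (hPQ : ∀ n, Disjoint (P n) (Q n)) :
    ∃ (σ : X → X) (B' : Set X), IsFold G B B' σ ∧
      (∀ n, ∀ x ∈ B ∩ P n, g n • x ∈ B ∩ Q n → σ x ≠ x ∨ σ (g n • x) ≠ g n • x) ∧
      ∀ x, σ x ≠ x → ∃ n, (x ∈ P n ∧ σ x ∈ Q n) ∨ (x ∈ Q n ∧ σ x ∈ P n) := by
  classical
  set U : ℕ → Set X := greedyRest g P Q B with hU
  set S : ℕ → Set X := fun n => greedySource g P Q (U n) n with hS
  set T : ℕ → Set X := fun n => greedyTarget g P Q (U n) n with hT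
  have hUsucc : ∀ n, U (n + 1) = U n \ (S n ∪ T n) := fun n => rfl
  have memS : ∀ n x, x ∈ S n ↔ (x ∈ U n ∧ x ∈ P n) ∧ g n • x ∈ U n ∧ g n • x ∈ Q n :=
    fun n x => Iff.rfl
  have memT : ∀ n x, x ∈ T n ↔ (g n)⁻¹ • x ∈ S n := fun n x => Iff.rfl
  have hTS : ∀ n x, x ∈ T n → x ∈ U n ∧ x ∈ Q n ∧ (g n)⁻¹ • x ∈ P n := by
    intro n x hx
    have := (memS n _).1 ((memT n x).1 hx)
    rw [smul_inv_smul] at this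
    exact ⟨this.2.1, this.2.2, this.1.2⟩
  have hanti : Antitone U := antitone_nat_of_succ_le fun n => by
    rw [hUsucc]; exact Set.sdiff_subset
  have hUB : ∀ n, U n ⊆ B := fun n => hanti (Nat.zero_le n)
  have hSTU : ∀ n x, x ∈ S n ∪ T n → x ∈ U n := by
    rintro n x (hx | hx)
    · exact hx.1.1
    · exact (hTS n x hx).1
  have huniq : ∀ n m x, x ∈ S n ∪ T n → x ∈ S m ∪ T m → n = m := by
    have key : ∀ n m x, n < m → x ∈ S n ∪ T n → x ∈ S m ∪ T m → False := by
      intro n m x hnm hn hm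
      have : x ∈ U (n + 1) := hanti hnm (hSTU m x hm)
      rw [hUsucc] at this
      exact this.2 hn
    intro n m x hn hm
    by_contra hne
    rcases lt_or_gt_of_ne hne with h | h
    · exact key n m x h hn hm
    · exact key m n x h hm hn
  have hST : ∀ n m x, x ∈ S n → x ∈ T m → False := by
    intro n m x hn hm
    obtain rfl := huniq n m x (Or.inl hn) (Or.inr hm)
    exact Set.disjoint_left.1 (hPQ n) hn.1.2 (hTS n x hm).2.1
  have hsrc : ∀ n x, x ∈ S n → g n • x ∈ T n := by
    intro n x hx
    rw [memT, inv_smul_smul]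
    exact hx
  set σ : X → X := fun x =>
    if h : ∃ n, x ∈ S n then g h.choose • x
    else if h : ∃ n, x ∈ T n then (g h.choose)⁻¹ • x else x with hσ
  have hσS : ∀ n x, x ∈ S n → σ x = g n • x := by
    intro n x hx
    have h : ∃ n, x ∈ S n := ⟨n, hx⟩
    have h2 : h.choose = n := huniq _ _ x (Or.inl h.choose_spec) (Or.inl hx)
    simp only [hσ, dif_pos h, h2]
  have hσT : ∀ n x, x ∈ T n → σ x = (g n)⁻¹ • x := by
    intro n x hx
    have h0 : ¬ ∃ n, x ∈ S n := fun ⟨m, hm⟩ => hST m n x hm hx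
    have h : ∃ n, x ∈ T n := ⟨n, hx⟩
    have h2 : h.choose = n := huniq _ _ x (Or.inr h.choose_spec) (Or.inr hx)
    simp only [hσ, dif_neg h0, dif_pos h, h2]
  have hσ0 : ∀ x, (∀ n, x ∉ S n) → (∀ n, x ∉ T n) → σ x = x := by
    intro x h1 h2
    have h1' : ¬ ∃ n, x ∈ S n := fun ⟨m, hm⟩ => h1 m hm
    have h2' : ¬ ∃ n, x ∈ T n := fun ⟨m, hm⟩ => h2 m hm
    simp only [hσ, dif_neg h1', dif_neg h2']
  have hcases : ∀ x, (∃ n, x ∈ S n) ∨ (∃ n, x ∈ T n) ∨ ((∀ n, x ∉ S n) ∧ ∀ n, x ∉ T n) := by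
    intro x
    by_cases h1 : ∃ n, x ∈ S n
    · exact Or.inl h1
    by_cases h2 : ∃ n, x ∈ T n
    · exact Or.inr (Or.inl h2)
    · exact Or.inr (Or.inr ⟨fun n h => h1 ⟨n, h⟩, fun n h => h2 ⟨n, h⟩⟩)
  have hmU : ∀ n, MeasurableSet (U n) := by
    have hsm : ∀ n (V : Set X), MeasurableSet V → MeasurableSet (greedySource g P Q V n) :=
      fun n V hV => (hV.inter (hP n)).inter (hmeas _ (hV.inter (hQ n)))
    intro n
    induction n with
    | zero => exact hB
    | succ n ih =>
      rw [hUsucc]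
      exact ih.diff ((hsm n _ ih).union (hmeas _ (hsm n _ ih)))
  have hmS : ∀ n, MeasurableSet (S n) := fun n =>
    ((hmU n).inter (hP n)).inter (hmeas _ ((hmU n).inter (hQ n)))
  have hmT : ∀ n, MeasurableSet (T n) := fun n => hmeas _ (hmS n)
  have hmσ : Measurable σ := by
    refine measurable_of_countable_cover (ι := Option (ℕ ⊕ ℕ))
      (fun i => match i with
        | none => (⋃ n, S n ∪ T n)ᶜ
        | some (Sum.inl n) => S n
        | some (Sum.inr n) => T n)
      (fun i => match i with
        | none => id
        | some (Sum.inl n) => fun x => g n • x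
        | some (Sum.inr n) => fun x => (g n)⁻¹ • x) ?_ ?_ ?_ ?_
    · rintro (_ | n | n)
      · exact (MeasurableSet.iUnion fun n => (hmS n).union (hmT n)).compl
      · exact hmS n
      · exact hmT n
    · rintro (_ | n | n)
      · exact measurable_id
      · exact hmeas _
      · exact hmeas _
    · intro x
      rcases hcases x with ⟨n, h⟩ | ⟨n, h⟩ | ⟨h1, h2⟩
      · exact ⟨some (Sum.inl n), h⟩
      · exact ⟨some (Sum.inr n), h⟩
      · exact ⟨none, by simp [h1, h2]⟩
    · rintro (_ | n | n) x hx
      · simp only [Set.mem_compl_iff, Set.mem_iUnion, Set.mem_union, not_exists, not_or] at hx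
        exact hσ0 x (fun n => (hx n).1) fun n => (hx n).2
      · exact hσS n x hx
      · exact hσT n x hx
  refine ⟨σ, B \ ⋃ n, T n, ⟨hmσ, hB.diff (MeasurableSet.iUnion hmT), Set.sdiff_subset,
    ?_, ?_, ?_, ?_, ?_⟩, ?_, ?_⟩
  · intro x
    rcases hcases x with ⟨n, h⟩ | ⟨n, h⟩ | ⟨h1, h2⟩
    · rw [hσS n x h, hσT n _ (hsrc n x h), inv_smul_smul]
    · rw [hσT n x h, hσS n _ h, smul_inv_smul]
    · rw [hσ0 x h1 h2, hσ0 x h1 h2]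
  · intro x
    rcases hcases x with ⟨n, h⟩ | ⟨n, h⟩ | ⟨h1, h2⟩
    · rw [hσS n x h]; exact MulAction.mem_orbit _ _
    · rw [hσT n x h]; exact MulAction.mem_orbit _ _
    · rw [hσ0 x h1 h2]; exact MulAction.mem_orbit_self _
  · intro x hx
    exact hσ0 x (fun n h => hx (hUB n (hSTU n x (Or.inl h))))
      fun n h => hx (hUB n (hSTU n x (Or.inr h)))
  · intro x hx hx'
    have : ∃ n, x ∈ T n := by
      by_contra hcon
      exact hx' ⟨hx, by simpa using hcon⟩
    obtain ⟨n, h⟩ := this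
    rw [hσT n x h]
    refine ⟨hUB n (hSTU n _ (Or.inl h)), ?_⟩
    simp only [Set.mem_iUnion, not_exists]
    exact fun m hm => hST n m _ h hm
  · rintro x ⟨hxB, hx⟩ hne hmem
    simp only [Set.mem_iUnion, not_exists] at hx
    rcases hcases x with ⟨n, h⟩ | ⟨n, h⟩ | ⟨h1, h2⟩
    · exact hmem.2 (Set.mem_iUnion.2 ⟨n, hσS n x h ▸ hsrc n x h⟩)
    · exact hx n h
    · exact hne (hσ0 x h1 h2)
  · rintro n x ⟨hxB, hxP⟩ ⟨hgB, hgQ⟩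
    have hfix : ∀ y ∈ B, σ y = y → y ∈ U n := by
      intro y hyB hy
      have : ∀ m, y ∈ U m := by
        intro m
        induction m with
        | zero => exact hyB
        | succ m ih =>
          rw [hUsucc]
          refine ⟨ih, ?_⟩
          rintro (h | h)
          · have h3 := hσS m y h
            rw [hy] at h3
            exact Set.disjoint_left.1 (hPQ m) h.1.2 (h3 ▸ h.2.2)
          · have h3 := hσT m y h
            rw [hy] at h3
            have h4 := hTS m y h
            exact Set.disjoint_left.1 (hPQ m) (h3 ▸ h4.2.2) h4.2.1
      exact this n
    by_contra! hcon
    have hne : g n • x ≠ x := fun h => Set.disjoint_left.1 (hPQ n) hxP (h ▸ hgQ)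
    have hxS : x ∈ S n := (memS n x).2
      ⟨⟨hfix x hxB hcon.1, hxP⟩, hfix _ hgB hcon.2, hgQ⟩
    exact hne ((hσS n x hxS).symm.trans hcon.1)
  · intro x hne
    rcases hcases x with ⟨n, h⟩ | ⟨n, h⟩ | ⟨h1, h2⟩
    · exact ⟨n, Or.inl ⟨h.1.2, hσS n x h ▸ h.2.2⟩⟩
    · exact ⟨n, Or.inr ⟨(hTS n x h).2.1, hσT n x h ▸ (hTS n x h).2.2⟩⟩
    · exact absurd (hσ0 x h1 h2) hne

/-- A Borel set can be folded so that at most one point of each orbit is left fixed and, given two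
disjoint Borel subsets `L` and `H`, in each orbit one of them is completely matched into the
other. -/
theorem exists_isFold [Countable G] [StandardBorelSpace X]
    (hmeas : ∀ g : G, Measurable (fun x : X => g • x))
    {B L H : Set X} (hB : MeasurableSet B) (hL : MeasurableSet L) (hH : MeasurableSet H)
    (hLB : L ⊆ B) (hHB : H ⊆ B) (hLH : Disjoint L H) :
    ∃ (σ : X → X) (B' : Set X), IsFold G B B' σ ∧
      (∀ x ∈ B, ∀ y ∈ B, σ x = x → σ y = y → y ∈ MulAction.orbit G x → x = y) ∧
      ∀ x ∈ L, ∀ y ∈ H, y ∈ MulAction.orbit G x → σ x ∈ H ∨ σ y ∈ L := by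
  obtain ⟨e, he⟩ := exists_surjective_nat G
  obtain ⟨C, hC, hCsep⟩ := exists_seq_separating X MeasurableSet.univ (Set.univ : Set X)
  obtain ⟨σ₁, B₁, h₁, hmatch₁, hpair₁⟩ := exists_isFold_greedy hmeas hB e
    (fun _ => hL) (fun _ => hH) (fun _ => hLH)
  set R : Set X := {x | x ∈ B ∧ σ₁ x = x} with hR
  have hRm : MeasurableSet R := hB.inter (measurableSet_eq_fun h₁.measurable measurable_id)
  obtain ⟨σ₂, B₂, h₂, hmatch₂, -⟩ := exists_isFold_greedy hmeas hRm
    (fun k => e k.unpair.1) (P := fun k => C k.unpair.2) (Q := fun k => (C k.unpair.2)ᶜ)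
    (fun _ => hC _) (fun _ => (hC _).compl) (fun _ => disjoint_compl_right)
  have hσ₂ : ∀ x, σ₁ x ≠ x → σ₂ x = x := fun x hx => h₂.eq_self x fun h => hx h.2
  have hRR : ∀ x ∈ R, σ₁ (σ₂ x) = σ₂ x := fun x hx => (h₂.mem hx).2
  have hval₁ : ∀ x, σ₁ x ≠ x → σ₁ (σ₂ x) = σ₁ x := fun x hx => by rw [hσ₂ x hx]
  have hmove : ∀ x, σ₁ x ≠ x → σ₁ (σ₁ x) ≠ σ₁ x := fun x hx h => hx (h₁.involutive.injective h)
  have hout : ∀ x, σ₁ x = x → x ∉ R → x ∉ B := fun x hx hxR hxB => hxR ⟨hxB, hx⟩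
  have hB₁ : ∀ x, σ₁ x ≠ x → x ∈ B := fun x hx => by
    by_contra h
    exact hx (h₁.eq_self x h)
  have hB₂R : ∀ x, σ₁ x ≠ x → x ∉ B₂ := fun x hx h => hx (h₂.subset h).2
  refine ⟨fun x => σ₁ (σ₂ x), (B₁ \ R) ∪ B₂,
    ⟨h₁.measurable.comp h₂.measurable, (h₁.measurableSet.diff hRm).union h₂.measurableSet,
    ?_, ?_, ?_, ?_, ?_, ?_⟩, ?_, ?_⟩
  · exact Set.union_subset (Set.sdiff_subset.trans h₁.subset) fun x hx => (h₂.subset hx).1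
  · intro x
    by_cases hx : σ₁ x = x
    · by_cases hxR : x ∈ R
      · simp only [hRR x hxR, h₂.involutive x, hx]
      · simp only [h₂.eq_self x hxR, hx]
    · simp only [hval₁ x hx, hval₁ _ (hmove x hx), h₁.involutive x]
  · intro x
    have h := h₁.mem_orbit (σ₂ x)
    rwa [MulAction.orbit_eq_iff.2 (h₂.mem_orbit x)] at h
  · intro x hx
    have : x ∉ R := fun h => hx h.1
    simp only [h₂.eq_self x this, h₁.eq_self x hx]
  · intro x hxB hx
    simp only [Set.mem_union, Set.mem_sdiff, not_or, not_and, not_not] at hx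
    by_cases hfix : σ₁ x = x
    · have hxR : x ∈ R := ⟨hxB, hfix⟩
      simp only [hRR x hxR]
      exact Or.inr (h₂.mem_of_notMem x hxR hx.2)
    · simp only [hval₁ x hfix]
      exact Or.inl ⟨h₁.mem_of_notMem x hxB fun h => hfix (hx.1 h).2,
        fun h => hmove x hfix h.2⟩
  · rintro x (hx | hx) hne hmem
    · have hfix : σ₁ x ≠ x := fun h => hx.2 ⟨h₁.subset hx.1, h⟩
      simp only [hval₁ x hfix] at hmem
      rcases hmem with h | h
      · exact h₁.notMem_of_mem x hx.1 hfix h.1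
      · exact hB₂R _ (hmove x hfix) h
    · have hxR := h₂.subset hx
      simp only [hRR x hxR] at hmem hne
      rcases hmem with h | h
      · exact h.2 (h₂.mem hxR)
      · exact h₂.notMem_of_mem x hx hne h
  · intro x hxB y hyB hx hy hxy
    have hfixed : ∀ z ∈ B, σ₁ (σ₂ z) = z → z ∈ R ∧ σ₂ z = z := by
      intro z hzB hz
      have hzR : z ∈ R := by
        by_contra hzR
        have : σ₁ z ≠ z := fun h => hzR ⟨hzB, h⟩
        exact this ((hval₁ z this).symm.trans hz)
      exact ⟨hzR, (hRR z hzR).symm.trans hz⟩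
    have key : ∀ x y, x ∈ R → y ∈ R → σ₂ x = x → σ₂ y = y → y ∈ MulAction.orbit G x →
        ∀ j, x ∈ C j → y ∈ C j := by
      rintro x y hxR hyR hx hy ⟨a, rfl⟩ j hxj
      by_contra hyj
      obtain ⟨i, rfl⟩ := he a
      have := hmatch₂ (Nat.pair i j) x (by simpa using ⟨hxR, hxj⟩)
      simp only [Nat.unpair_pair] at this
      rcases this ⟨hyR, hyj⟩ with h | h
      · exact h hx
      · exact h hy
    obtain ⟨hxR, hx'⟩ := hfixed x hxB hx
    obtain ⟨hyR, hy'⟩ := hfixed y hyB hy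
    exact hCsep x trivial y trivial fun j => ⟨key x y hxR hyR hx' hy' hxy j,
      key y x hyR hxR hy' hx' (MulAction.mem_orbit_symm.1 hxy) j⟩
  · rintro x hxL y hyH ⟨a, rfl⟩
    obtain ⟨i, rfl⟩ := he a
    rcases hmatch₁ i x ⟨hLB hxL, hxL⟩ ⟨hHB hyH, hyH⟩ with h | h
    · left
      obtain ⟨-, h' | h'⟩ := hpair₁ x h
      · simpa only [hval₁ x h] using h'.2
      · exact absurd h'.1 (Set.disjoint_left.1 hLH hxL)
    · right
      obtain ⟨-, h' | h'⟩ := hpair₁ _ h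
      · exact absurd hyH (Set.disjoint_left.1 hLH h'.1)
      · simpa only [hval₁ _ h] using h'.2

end

section

variable {G X : Type*} [Group G] [MulAction G X] [MeasurableSpace X]

/-- A sequence of successive foldings `σ n` of `B n` onto `B (n + 1)`, together with the averages
`f n k` of the indicators of the sets `A k` over the resulting finite classes, such that the `n`-th
folding matches points of small average with points of large average, as far as possible. -/
structure IsFoldSequence (G : Type*) {X : Type*} [Group G] [MulAction G X] [MeasurableSpace X]
    (A : ℕ → Set X) (B : ℕ → Set X) (σ : ℕ → X → X) (f : ℕ → ℕ → X → ℝ) : Prop where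
  base : B 0 = Set.univ
  zero_eq : ∀ k, f 0 k = (A k).indicator 1
  measurable : ∀ n k, Measurable (f n k)
  succ : ∀ n k x, f (n + 1) k x = (f n k x + f n k (σ n x)) / 2
  isFold : ∀ n, IsFold G (B n) (B (n + 1)) (σ n)
  eq_of_fixed : ∀ n, ∀ x ∈ B n, ∀ y ∈ B n, σ n x = x → σ n y = y → y ∈ MulAction.orbit G x → x = y
  match_or_match : ∀ n, ∀ x ∈ B n, ∀ y ∈ B n, y ∈ MulAction.orbit G x →
    f n n.unpair.1 x < 1 / 3 → 2 / 3 < f n n.unpair.1 y →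
    2 / 3 < f n n.unpair.1 (σ n x) ∨ f n n.unpair.1 (σ n y) < 1 / 3

theorem IsFoldSequence.measurableSet {A : ℕ → Set X} {B : ℕ → Set X} {σ : ℕ → X → X}
    {f : ℕ → ℕ → X → ℝ} (h : IsFoldSequence G A B σ f) (n : ℕ) : MeasurableSet (B n) := by
  cases n with
  | zero => rw [h.base]; exact MeasurableSet.univ
  | succ n => exact (h.isFold n).measurableSet

/-- Two Borel sets such that no orbit meets both cannot both have positive measure for an ergodic
invariant measure. -/
theorem measure_eq_zero_or_of_no_common_orbit
    [Countable G] (hmeas : ∀ g : G, Measurable (fun x : X => g • x)) {ν : Measure X}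
    (hν : IsErgodicInvariant G ν) {s t : Set X} (hs : MeasurableSet s)
    (hst : ∀ x ∈ s, ∀ y ∈ t, y ∉ MulAction.orbit G x) : ν s = 0 ∨ ν t = 0 := by
  obtain ⟨hprob, -, herg⟩ := hν
  set V : Set X := ⋃ g : G, (fun x : X => g • x) ⁻¹' s with hV
  have hVm : MeasurableSet V := MeasurableSet.iUnion fun g => hmeas g hs
  have hVinv : ∀ g : G, (fun x : X => g • x) ⁻¹' V = V := by
    intro g
    ext x
    simp only [hV, Set.mem_preimage, Set.mem_iUnion]
    constructor
    · rintro ⟨a, ha⟩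
      exact ⟨a * g, by rwa [mul_smul]⟩
    · rintro ⟨a, ha⟩
      exact ⟨a * g⁻¹, by rwa [mul_smul, inv_smul_smul]⟩
  have hsV : s ⊆ V := fun x hx => Set.mem_iUnion.2 ⟨1, by simpa using hx⟩
  refine (herg V hVm hVinv).imp (measure_mono_null hsV) fun h1 => ?_
  refine measure_mono_null ?_ ((prob_compl_eq_zero_iff hVm).2 h1)
  intro y hy hyV
  obtain ⟨g, hg⟩ := Set.mem_iUnion.1 hyV
  exact hst _ hg y hy ⟨g⁻¹, inv_smul_smul g y⟩

variable [Countable G] [StandardBorelSpace X]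

theorem exists_isFoldSequence (hmeas : ∀ g : G, Measurable (fun x : X => g • x))
    {A : ℕ → Set X} (hA : ∀ k, MeasurableSet (A k)) :
    ∃ B σ f, IsFoldSequence G A B σ f := by
  let State := {p : Set X × (ℕ → X → ℝ) // MeasurableSet p.1 ∧ ∀ k, Measurable (p.2 k)}
  have step : ∀ (n : ℕ) (s : State), ∃ (t : State) (σ : X → X),
      (∀ k x, t.1.2 k x = (s.1.2 k x + s.1.2 k (σ x)) / 2) ∧ IsFold G s.1.1 t.1.1 σ ∧
      (∀ x ∈ s.1.1, ∀ y ∈ s.1.1, σ x = x → σ y = y → y ∈ MulAction.orbit G x → x = y) ∧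
      ∀ x ∈ s.1.1, ∀ y ∈ s.1.1, y ∈ MulAction.orbit G x →
        s.1.2 n.unpair.1 x < 1 / 3 → 2 / 3 < s.1.2 n.unpair.1 y →
        2 / 3 < s.1.2 n.unpair.1 (σ x) ∨ s.1.2 n.unpair.1 (σ y) < 1 / 3 := by
    rintro n ⟨⟨B, f⟩, hB, hf⟩
    obtain ⟨σ, B', h, hfix, hmatch⟩ := exists_isFold hmeas hB
      (hB.inter (measurableSet_lt (hf n.unpair.1) (measurable_const (a := (1 / 3 : ℝ)))))
      (hB.inter (measurableSet_lt (measurable_const (a := (2 / 3 : ℝ))) (hf n.unpair.1)))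
      Set.inter_subset_left Set.inter_subset_left (by
        rw [Set.disjoint_left]
        rintro x ⟨-, h1⟩ ⟨-, h2⟩
        simp only [Set.mem_ofPred_eq] at h1 h2
        linarith)
    refine ⟨⟨⟨B', fun k x => (f k x + f k (σ x)) / 2⟩, h.measurableSet, fun k =>
      ((hf k).add ((hf k).comp h.measurable)).div_const 2⟩, σ, fun _ _ => rfl, h, hfix, ?_⟩
    intro x hx y hy hxy h1 h2
    exact (hmatch x ⟨hx, h1⟩ y ⟨hy, h2⟩ hxy).imp (fun h => h.2) fun h => h.2
  choose t σ hstep using step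
  let s₀ : State := ⟨⟨Set.univ, fun k => (A k).indicator 1⟩, MeasurableSet.univ,
    fun k => measurable_one.indicator (hA k)⟩
  let s : ℕ → State := fun n => Nat.rec s₀ (fun n s => t n s) n
  exact ⟨fun n => (s n).1.1, fun n => σ n (s n), fun n => (s n).1.2, rfl, fun _ => rfl,
    fun n => (s n).2.2, fun n => (hstep n (s n)).1, fun n => (hstep n (s n)).2.1,
    fun n => (hstep n (s n)).2.2.1, fun n => (hstep n (s n)).2.2.2⟩

theorem IsFold.measurePreserving (hmeas : ∀ g : G, Measurable (fun x : X => g • x))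
    {ν : Measure X} (hν : ∀ g : G, MeasurePreserving (fun x : X => g • x) ν ν)
    {B B' : Set X} {σ : X → X} (h : IsFold G B B' σ) : MeasurePreserving σ ν ν :=
  measurePreserving_of_mem_orbit hmeas hν h.measurable h.involutive.bijective h.mem_orbit

/-- The integral over `B` is computed on `B'` by summing over the pairs of the folding. -/
theorem IsFold.setIntegral_add_comp (hmeas : ∀ g : G, Measurable (fun x : X => g • x))
    (haper : ∀ x : X, (MulAction.orbit G x).Infinite)
    {ν : Measure X} [IsFiniteMeasure ν]
    (hν : ∀ g : G, MeasurePreserving (fun x : X => g • x) ν ν)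
    {B B' : Set X} {σ : X → X} (h : IsFold G B B' σ) (hB : MeasurableSet B)
    (hfix : ∀ x ∈ B, ∀ y ∈ B, σ x = x → σ y = y → y ∈ MulAction.orbit G x → x = y)
    {u : X → ℝ} (hu : Integrable u ν) :
    ∫ x in B', (u x + u (σ x)) ∂ν = ∫ x in B, u x ∂ν := by
  have hpres := h.measurePreserving hmeas hν
  have hemb : MeasurableEmbedding σ := h.measurable.measurableEmbedding h.involutive.injective
  have hF : ν {x | x ∈ B ∧ σ x = x} = 0 :=
    measure_eq_zero_of_partial_transversal hmeas haper hν
      (hB.inter (measurableSet_eq_fun h.measurable measurable_id))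
      fun x hx y hy => hfix x hx.1 y hy.1 hx.2 hy.2
  have hae : (σ ⁻¹' (B \ B') : Set X) =ᵐ[ν] B' := by
    refine Filter.EventuallyLE.antisymm (Filter.Eventually.of_forall ?_) ?_
    · intro x hx
      have := h.mem_of_notMem _ hx.1 hx.2
      rwa [h.involutive x] at this
    · have : ∀ᵐ x ∂ν, x ∉ {x | x ∈ B ∧ σ x = x} := measure_eq_zero_iff_ae_notMem.1 hF
      filter_upwards [this] with x hx hxB'
      have hxB := h.subset hxB'
      exact ⟨h.mem hxB, h.notMem_of_mem x hxB' fun hfx => hx ⟨hxB, hfx⟩⟩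
  have huσ : Integrable (fun x => u (σ x)) ν := hpres.integrable_comp_of_integrable hu
  rw [integral_add hu.integrableOn huσ.integrableOn, ← setIntegral_congr_set hae,
    ← setIntegral_congr_set hae, hpres.setIntegral_preimage_emb hemb, setIntegral_congr_set hae,
    ← setIntegral_union Set.disjoint_sdiff_right (hB.diff h.measurableSet) hu.integrableOn
      hu.integrableOn, Set.union_sdiff_cancel h.subset]

end

section

variable {G X : Type*} [Group G] [MulAction G X] [Countable G] [MeasurableSpace X]
  [StandardBorelSpace X]

/-- If `f` is close in mean to the indicator of `D`, then `f` is small on a large set when `D` is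
not conull, and large on a large set when `D` is not null. -/
theorem indicator_le_add_abs_sub {X : Type*} (D : Set X) (f : X → ℝ) (x : X) :
    1 - D.indicator 1 x ≤
        {y | f y < 1 / 3}.indicator 1 x + 3 * |f x - D.indicator (1 : X → ℝ) x| ∧
      D.indicator 1 x ≤
        {y | 2 / 3 < f y}.indicator 1 x + 3 * |f x - D.indicator (1 : X → ℝ) x| := by
  have hd : D.indicator (1 : X → ℝ) x = 0 ∨ D.indicator (1 : X → ℝ) x = 1 := by
    by_cases hx : x ∈ D <;> simp [hx]
  have habs := abs_nonneg (f x - D.indicator (1 : X → ℝ) x)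
  have h1 := le_abs_self (f x - D.indicator (1 : X → ℝ) x)
  have h2 := neg_le_abs (f x - D.indicator (1 : X → ℝ) x)
  constructor
  · by_cases hx : f x < 1 / 3
    · rw [Set.indicator_of_mem (s := {y | f y < 1 / 3}) hx, Pi.one_apply]
      rcases hd with hd | hd <;> linarith
    · rw [Set.indicator_of_notMem (s := {y | f y < 1 / 3}) hx]
      rcases hd with hd | hd <;> linarith
  · by_cases hx : 2 / 3 < f x
    · rw [Set.indicator_of_mem (s := {y | 2 / 3 < f y}) hx, Pi.one_apply]
      rcases hd with hd | hd <;> linarith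
    · rw [Set.indicator_of_notMem (s := {y | 2 / 3 < f y}) hx]
      rcases hd with hd | hd <;> linarith

/-- For an ergodic invariant measure, a Borel set invariant under all the foldings of a fold
sequence, and approximable by the sets `A k`, is null or conull. -/
theorem IsFoldSequence.measure_eq_zero_or_one
    (hmeas : ∀ g : G, Measurable (fun x : X => g • x))
    (haper : ∀ x : X, (MulAction.orbit G x).Infinite)
    {A : ℕ → Set X} {B : ℕ → Set X} {σ : ℕ → X → X} {f : ℕ → ℕ → X → ℝ}
    (h : IsFoldSequence G A B σ f) {ν : Measure X} (hν : IsErgodicInvariant G ν)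
    {D : Set X} (hD : MeasurableSet D) (hDσ : ∀ n x, σ n x ∈ D ↔ x ∈ D)
    (happrox : ∀ ε : ℝ, 0 < ε → ∃ k, ν.real (symmDiff D (A k)) < ε)
    (hA : ∀ k, MeasurableSet (A k)) :
    ν D = 0 ∨ ν D = 1 := by
  have hprob := hν.1
  have hinv := hν.2.1
  by_contra! hcon
  set p : ℝ := ν.real D with hp
  have hp0 : 0 < p := ENNReal.toReal_pos hcon.1 (measure_ne_top _ _)
  have hp1 : p < 1 := by
    refine lt_of_le_of_ne measureReal_le_one fun h1 => hcon.2 ?_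
    rw [← ENNReal.toReal_eq_one_iff]
    exact h1
  obtain ⟨a, ha0, hap, hap'⟩ : ∃ a : ℝ, 0 < a ∧ a ≤ p ∧ a ≤ 1 - p :=
    ⟨min p (1 - p), lt_min hp0 (by linarith), min_le_left _ _, min_le_right _ _⟩
  obtain ⟨k, hk⟩ := happrox (a / 6) (by linarith)
  set I : ℕ → (X → ℝ) → ℝ := fun n u => 2 ^ n * ∫ x in B n, u x ∂ν with hI
  have hbdd : ∀ u : X → ℝ, Measurable u → (∀ x, |u x| ≤ 2) → Integrable u ν := fun u hu hb =>
    Integrable.of_bound hu.aestronglyMeasurable 2 (Filter.Eventually.of_forall hb)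
  have hfold : ∀ n (u v : X → ℝ), Integrable u ν → (∀ x, v x = (u x + u (σ n x)) / 2) →
      I (n + 1) v = I n u := by
    intro n u v hu hv
    have h1 := (h.isFold n).setIntegral_add_comp hmeas haper hinv (h.measurableSet n)
      (h.eq_of_fixed n) hu
    simp only [hI, hv, integral_div, h1, pow_succ]
    ring
  have hadd : ∀ n (u v : X → ℝ), Integrable u ν → Integrable v ν →
      I n (fun x => u x + v x) = I n u + I n v := by
    intro n u v hu hv
    simp only [hI, integral_add hu.integrableOn hv.integrableOn, mul_add]
  have hmono : ∀ n (u v : X → ℝ), Integrable u ν → Integrable v ν →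
      (∀ᵐ x ∂ν, x ∈ B n → u x ≤ v x) →
      I n u ≤ I n v := by
    intro n u v hu hv huv
    refine mul_le_mul_of_nonneg_left ?_ (by positivity)
    refine integral_mono_ae hu.integrableOn hv.integrableOn ?_
    exact (ae_restrict_iff' (h.measurableSet n)).2 huv
  have hmul : ∀ n (c : ℝ) (u : X → ℝ), I n (fun x => c * u x) = c * I n u := by
    intro n c u
    simp only [hI, integral_const_mul]
    ring
  have hI0 : ∀ u, I 0 u = ∫ x, u x ∂ν := fun u => by simp [hI, h.base]
  set d : X → ℝ := D.indicator 1 with hd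
  have hdm : Measurable d := measurable_one.indicator hD
  have hd01 : ∀ x, 0 ≤ d x ∧ d x ≤ 1 := fun x => by
    by_cases hx : x ∈ D <;> simp [hd, hx]
  have hdσ : ∀ n x, d (σ n x) = d x := fun n x => by
    by_cases hx : x ∈ D
    · simp [hd, hx, (hDσ n x).2 hx]
    · simp [hd, hx, (hDσ n x).not.2 hx]
  have hdi : Integrable d ν := hbdd d hdm fun x => by
    rw [abs_le]; constructor <;> linarith [hd01 x]
  have hId : ∀ n, I n d = p := by
    intro n
    induction n with
    | zero => rw [hI0, hd, integral_indicator_one hD]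
    | succ n ih => rw [hfold n d d hdi fun x => by rw [hdσ]; ring, ih]
  have hone : Integrable (fun _ : X => (1 : ℝ)) ν := integrable_const 1
  have hI1 : ∀ n, I n (fun _ => 1) = 1 := by
    intro n
    induction n with
    | zero => rw [hI0]; simp
    | succ n ih => rw [hfold n _ (fun _ => 1) hone fun x => by norm_num, ih]
  set F : ℕ → X → ℝ := fun n => f n k with hF
  have hFm : ∀ n, Measurable (F n) := fun n => h.measurable n k
  have hFs : ∀ n x, F (n + 1) x = (F n x + F n (σ n x)) / 2 := fun n => h.succ n k
  have hF01 : ∀ n x, 0 ≤ F n x ∧ F n x ≤ 1 := by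
    intro n
    induction n with
    | zero =>
      intro x
      by_cases hx : x ∈ A k <;> simp [hF, h.zero_eq, hx]
    | succ n ih =>
      intro x
      rw [hFs]
      constructor <;> linarith [ih x, ih (σ n x)]
  have hσm : ∀ n, Measurable (σ n) := fun n => (h.isFold n).measurable
  -- the averages stay close to the indicator of `D`
  have hei : ∀ n, Integrable (fun x => |F n x - d x|) ν := fun n =>
    hbdd _ (((hFm n).sub hdm).abs) fun x => by
      rw [abs_abs, abs_le]; constructor <;> linarith [hd01 x, hF01 n x]
  have he : ∀ n, I n (fun x => |F n x - d x|) ≤ a / 6 := by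
    intro n
    induction n with
    | zero =>
      have : (fun x => |F 0 x - d x|) = (symmDiff D (A k)).indicator 1 := by
        ext x
        by_cases h1 : x ∈ A k <;> by_cases h2 : x ∈ D <;>
          simp [hF, h.zero_eq, hd, h1, h2, Set.mem_symmDiff]
      rw [hI0, this, integral_indicator_one (hD.symmDiff (hA k))]
      exact hk.le
    | succ n ih =>
      refine le_trans ?_ ih
      rw [← hfold n (fun x => |F n x - d x|) _ (hei n) fun x => rfl]
      have hm : Measurable fun x => (|F n x - d x| + |F n (σ n x) - d (σ n x)|) / 2 :=
        (((hFm n).sub hdm).abs.add (((hFm n).sub hdm).abs.comp (hσm n))).div_const 2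
      refine hmono _ _ _ (hei _) (hbdd _ hm fun x => ?_) (Filter.Eventually.of_forall fun x _ => ?_)
      · have h1 : |F n x - d x| ≤ 1 := by
          rw [abs_le]; constructor <;> linarith [hd01 x, hF01 n x]
        have h2 : |F n (σ n x) - d (σ n x)| ≤ 1 := by
          rw [abs_le]; constructor <;> linarith [hd01 (σ n x), hF01 n (σ n x)]
        rw [abs_le]
        constructor <;> linarith [abs_nonneg (F n x - d x), abs_nonneg (F n (σ n x) - d (σ n x))]
      · rw [hFs, hdσ]
        have : (F n x + F n (σ n x)) / 2 - d x = ((F n x - d x) + (F n (σ n x) - d x)) / 2 := by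
          ring
        rw [this, abs_div, abs_two]
        gcongr
        exact abs_add_le _ _
  -- both level sets are large
  have hind : ∀ s : Set X, MeasurableSet s → Integrable (s.indicator (1 : X → ℝ)) ν := fun s hs =>
    hone.indicator hs
  have hlow : ∀ n, MeasurableSet {x | F n x < 1 / 3} := fun n =>
    measurableSet_lt (hFm n) measurable_const
  have hhigh : ∀ n, MeasurableSet {x | 2 / 3 < F n x} := fun n =>
    measurableSet_lt measurable_const (hFm n)
  have hlarge : ∀ n, a / 2 ≤ I n ({x | F n x < 1 / 3}.indicator 1) ∧
      a / 2 ≤ I n ({x | 2 / 3 < F n x}.indicator 1) := by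
    intro n
    have hei3 := (hei n).const_mul 3
    constructor
    · have h1 := hmono n (fun x => 1 + (-1) * d x)
        (fun x => {x | F n x < 1 / 3}.indicator 1 x + 3 * |F n x - d x|)
        (hone.add (hdi.const_mul (-1))) ((hind _ (hlow n)).add hei3)
        (Filter.Eventually.of_forall fun x _ => by
          linarith [(indicator_le_add_abs_sub D (F n) x).1])
      rw [hadd n _ _ hone (hdi.const_mul (-1)), hadd n _ _ (hind _ (hlow n)) hei3, hmul, hmul,
        hI1, hId] at h1
      linarith [he n]
    · have h1 := hmono n d
        (fun x => {x | 2 / 3 < F n x}.indicator 1 x + 3 * |F n x - d x|)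
        hdi ((hind _ (hhigh n)).add hei3)
        (Filter.Eventually.of_forall fun x _ => (indicator_le_add_abs_sub D (F n) x).2)
      rw [hadd n _ _ (hind _ (hhigh n)) hei3, hmul, hId] at h1
      linarith [he n]
  -- the energy decreases at each folding, by a definite amount when `A k` is treated
  set w : ℕ → X → ℝ := fun n x => ((F n x - F n (σ n x)) / 2) ^ 2 with hw
  have hwb : ∀ n x, 0 ≤ w n x ∧ w n x ≤ 1 := by
    intro n x
    refine ⟨sq_nonneg _, ?_⟩
    have h1 := hF01 n x
    have h2 := hF01 n (σ n x)
    simp only [hw, sq_le_one_iff_abs_le_one, abs_le]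
    constructor <;> linarith
  have hwm : ∀ n, Measurable (w n) := fun n =>
    (((hFm n).sub ((hFm n).comp (hσm n))).div_const 2).pow_const 2
  have hwi : ∀ n, Integrable (w n) ν := fun n => hbdd _ (hwm n) fun x => by
    rw [abs_le]; constructor <;> linarith [hwb n x]
  have hsqi : ∀ n, Integrable (fun x => F n x ^ 2) ν := fun n =>
    hbdd _ ((hFm n).pow_const 2) fun x => by
      have := hF01 n x
      rw [abs_le]; constructor <;> nlinarith
  have henergy : ∀ n, I (n + 1) (fun x => F (n + 1) x ^ 2) =
      I n (fun x => F n x ^ 2) - I n (w n) := by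
    intro n
    have h1 := hfold n (fun x => F n x ^ 2 + (-1) * w n x) (fun x => F (n + 1) x ^ 2)
      ((hsqi n).add ((hwi n).const_mul (-1))) fun x => by
        simp only [hw, hFs, (h.isFold n).involutive x]
        ring
    rw [h1, hadd n _ _ (hsqi n) ((hwi n).const_mul (-1)), hmul]
    ring
  have hI_nonneg : ∀ n u, (∀ x, 0 ≤ u x) → 0 ≤ I n u := fun n u hu =>
    mul_nonneg (by positivity) (integral_nonneg hu)
  have hdrop : ∀ n, n.unpair.1 = k → a / 72 ≤ I n (w n) := by
    intro n hn
    have hmatch := h.match_or_match n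
    rw [hn] at hmatch
    have hbound : ∀ s : Set X, MeasurableSet s → a / 2 ≤ I n (s.indicator 1) →
        (∀ᵐ x ∂ν, x ∈ B n → x ∈ s → 1 / 36 ≤ w n x) → a / 72 ≤ I n (w n) := by
      intro s hs has hae
      have h1 := hmono n (s.indicator 1) (fun x => 36 * w n x) (hind s hs)
        ((hwi n).const_mul 36) (by
        filter_upwards [hae] with x hx hxB
        by_cases hxs : x ∈ s
        · simp only [Set.indicator_of_mem hxs, Pi.one_apply]
          linarith [hx hxB hxs]
        · simp only [Set.indicator_of_notMem hxs]
          linarith [hwb n x])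
      rw [hmul] at h1
      linarith
    have hwlow : ∀ x, F n x < 1 / 3 → 2 / 3 < F n (σ n x) → 1 / 36 ≤ w n x := by
      intro x h1 h2
      simp only [hw]
      nlinarith
    have hwhigh : ∀ x, 2 / 3 < F n x → F n (σ n x) < 1 / 3 → 1 / 36 ≤ w n x := by
      intro x h1 h2
      simp only [hw]
      nlinarith
    have hmL : MeasurableSet {x | (x ∈ B n ∧ F n x < 1 / 3) ∧ ¬ 2 / 3 < F n (σ n x)} :=
      ((h.measurableSet n).inter (hlow n)).inter ((hσm n) (hhigh n)).compl
    rcases measure_eq_zero_or_of_no_common_orbit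
      (t := {x | (x ∈ B n ∧ 2 / 3 < F n x) ∧ ¬ F n (σ n x) < 1 / 3}) hmeas hν hmL
      (fun x hx y hy hxy => (hmatch x hx.1.1 y hy.1.1 hxy hx.1.2 hy.1.2).elim hx.2 hy.2)
      with h0 | h0
    · refine hbound _ (hlow n) (hlarge n).1 ?_
      filter_upwards [measure_eq_zero_iff_ae_notMem.1 h0] with x hx hxB hxl
      refine hwlow x hxl ?_
      by_contra hc
      exact hx ⟨⟨hxB, hxl⟩, hc⟩
    · refine hbound _ (hhigh n) (hlarge n).2 ?_
      filter_upwards [measure_eq_zero_iff_ae_notMem.1 h0] with x hx hxB hxl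
      refine hwhigh x hxl ?_
      by_contra hc
      exact hx ⟨⟨hxB, hxl⟩, hc⟩
  set E : ℕ → ℝ := fun n => I n (fun x => F n x ^ 2) with hE
  have hanti : Antitone E := antitone_nat_of_succ_le fun n => by
    simp only [hE]
    rw [henergy]
    linarith [hI_nonneg n (w n) fun x => (hwb n x).1]
  have hiter : ∀ j : ℕ, ∃ n, E n ≤ E 0 - j * (a / 72) := by
    intro j
    induction j with
    | zero => exact ⟨0, by simp⟩
    | succ j ih =>
      obtain ⟨n, hn⟩ := ih
      refine ⟨Nat.pair k n + 1, ?_⟩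
      have h1 : E (Nat.pair k n) ≤ E n := hanti (Nat.right_le_pair k n)
      have h2 := hdrop (Nat.pair k n) (by simp)
      have h3 : E (Nat.pair k n + 1) = E (Nat.pair k n) - I (Nat.pair k n) (w (Nat.pair k n)) :=
        henergy _
      push_cast
      linarith
  obtain ⟨j, hj⟩ := exists_nat_gt (E 0 / (a / 72))
  rw [div_lt_iff₀ (by linarith)] at hj
  obtain ⟨n, hn⟩ := hiter j
  have : 0 ≤ E n := hI_nonneg n _ fun x => sq_nonneg _
  linarith

end

/-- The composition `σ 0 ∘ σ 1 ∘ ⋯ ∘ σ (n - 1)`. -/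
def compUpTo {X : Type*} (σ : ℕ → X → X) : ℕ → X → X
  | 0 => id
  | n + 1 => compUpTo σ n ∘ σ n

/-- The composition `σ (n - 1) ∘ ⋯ ∘ σ 1 ∘ σ 0`. -/
def compDownFrom {X : Type*} (σ : ℕ → X → X) : ℕ → X → X
  | 0 => id
  | n + 1 => σ n ∘ compDownFrom σ n

section

variable {G X : Type*} [Group G] [MulAction G X] [MeasurableSpace X]
  {A : ℕ → Set X} {B : ℕ → Set X} {σ : ℕ → X → X} {f : ℕ → ℕ → X → ℝ}

theorem IsFoldSequence.antitone (h : IsFoldSequence G A B σ f) : Antitone B :=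
  antitone_nat_of_succ_le fun n => (h.isFold n).subset

theorem IsFoldSequence.compDownFrom_compUpTo (h : IsFoldSequence G A B σ f) (n : ℕ) (x : X) :
    compDownFrom σ n (compUpTo σ n x) = x := by
  induction n generalizing x with
  | zero => rfl
  | succ n ih => simp [compDownFrom, compUpTo, ih, (h.isFold n).involutive x]

theorem IsFoldSequence.compUpTo_compDownFrom (h : IsFoldSequence G A B σ f) (n : ℕ) (x : X) :
    compUpTo σ n (compDownFrom σ n x) = x := by
  induction n generalizing x with
  | zero => rfl
  | succ n ih =>
    simp only [compDownFrom, compUpTo, Function.comp_apply, (h.isFold n).involutive _, ih]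

theorem IsFoldSequence.measurable_compUpTo (h : IsFoldSequence G A B σ f) (n : ℕ) :
    Measurable (compUpTo σ n) := by
  induction n with
  | zero => exact measurable_id
  | succ n ih => exact ih.comp (h.isFold n).measurable

theorem IsFoldSequence.measurable_compDownFrom (h : IsFoldSequence G A B σ f) (n : ℕ) :
    Measurable (compDownFrom σ n) := by
  induction n with
  | zero => exact measurable_id
  | succ n ih => exact (h.isFold n).measurable.comp ih

theorem IsFoldSequence.compUpTo_mem_orbit (h : IsFoldSequence G A B σ f) (n : ℕ) (x : X) :
    compUpTo σ n x ∈ MulAction.orbit G x := by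
  induction n generalizing x with
  | zero => exact MulAction.mem_orbit_self x
  | succ n ih =>
    have := ih (σ n x)
    rwa [MulAction.orbit_eq_iff.2 ((h.isFold n).mem_orbit x)] at this

theorem IsFoldSequence.compDownFrom_mem_orbit (h : IsFoldSequence G A B σ f) (n : ℕ) (x : X) :
    compDownFrom σ n x ∈ MulAction.orbit G x := by
  have := h.compUpTo_mem_orbit n (compDownFrom σ n x)
  rw [h.compUpTo_compDownFrom] at this
  exact MulAction.mem_orbit_symm.1 this

theorem IsFoldSequence.compUpTo_eq_of_notMem (h : IsFoldSequence G A B σ f) {n m : ℕ} {x : X}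
    (hx : x ∉ B n) (hnm : n ≤ m) : compUpTo σ m x = compUpTo σ n x := by
  induction m, hnm using Nat.le_induction with
  | base => rfl
  | succ m hnm ih =>
    rw [← ih, compUpTo, Function.comp_apply, (h.isFold m).eq_self x fun hm => hx (h.antitone hnm hm)]

open Classical in
/-- The limit of the compositions `σ 0 ∘ ⋯ ∘ σ n`, defined off `⋂ n, B n`: it maps each point to
its predecessor in the odometer order of its class. -/
noncomputable def foldLimit {X : Type*} (B : ℕ → Set X) (σ : ℕ → X → X) (x : X) : X :=
  if h : ∃ n, x ∉ B n then compUpTo σ (Nat.find h) x else x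

theorem IsFoldSequence.foldLimit_eq (h : IsFoldSequence G A B σ f) {n : ℕ} {x : X}
    (hx : x ∉ B n) : foldLimit B σ x = compUpTo σ n x := by
  classical
  have hex : ∃ n, x ∉ B n := ⟨n, hx⟩
  rw [foldLimit, dif_pos hex, h.compUpTo_eq_of_notMem (Nat.find_spec hex) (Nat.find_min' hex hx)]

theorem IsFoldSequence.foldLimit_mem_orbit (h : IsFoldSequence G A B σ f) (x : X) :
    foldLimit B σ x ∈ MulAction.orbit G x := by
  by_cases hx : ∃ n, x ∉ B n
  · obtain ⟨n, hn⟩ := hx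
    rw [h.foldLimit_eq hn]
    exact h.compUpTo_mem_orbit n x
  · rw [foldLimit, dif_neg hx]
    exact MulAction.mem_orbit_self x

theorem IsFoldSequence.measurable_foldLimit (h : IsFoldSequence G A B σ f) :
    Measurable (foldLimit B σ) := by
  refine measurable_of_countable_cover (ι := Option ℕ)
    (fun i => i.elim (⋂ n, B n) fun n => (B n)ᶜ) (fun i => i.elim id (compUpTo σ)) ?_ ?_ ?_ ?_
  · rintro (_ | n)
    · exact MeasurableSet.iInter h.measurableSet
    · exact (h.measurableSet n).compl
  · rintro (_ | n)
    · exact measurable_id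
    · exact h.measurable_compUpTo n
  · intro x
    by_cases hx : ∃ n, x ∉ B n
    · obtain ⟨n, hn⟩ := hx
      exact ⟨some n, hn⟩
    · push Not at hx
      exact ⟨none, Set.mem_iInter.2 hx⟩
  · rintro (_ | n) x hx
    · have : ¬ ∃ n, x ∉ B n := fun ⟨n, hn⟩ => hn (Set.mem_iInter.1 hx n)
      rw [foldLimit, dif_neg this]
      rfl
    · exact h.foldLimit_eq hx

theorem IsFoldSequence.foldLimit_injOn (h : IsFoldSequence G A B σ f) {x y : X}
    (hx : ∃ n, x ∉ B n) (hy : ∃ n, y ∉ B n) (hxy : foldLimit B σ x = foldLimit B σ y) :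
    x = y := by
  obtain ⟨n, hn⟩ := hx
  obtain ⟨m, hm⟩ := hy
  have hn' : x ∉ B (max n m) := fun h' => hn (h.antitone (le_max_left _ _) h')
  have hm' : y ∉ B (max n m) := fun h' => hm (h.antitone (le_max_right _ _) h')
  rw [h.foldLimit_eq hn', h.foldLimit_eq hm'] at hxy
  rw [← h.compDownFrom_compUpTo (max n m) x, hxy, h.compDownFrom_compUpTo]

/-- A set invariant under the limit map, where the limit exists, is invariant under all the
foldings. -/
theorem IsFoldSequence.mem_iff_of_foldLimit (h : IsFoldSequence G A B σ f) {D : Set X}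
    (hD : ∀ x, (∃ n, x ∉ B n) → (foldLimit B σ x ∈ D ↔ x ∈ D)) (n : ℕ) (x : X) :
    σ n x ∈ D ↔ x ∈ D := by
  induction n using Nat.strong_induction_on generalizing x with
  | _ n ih =>
    have hcomp : ∀ m ≤ n, ∀ x, compUpTo σ m x ∈ D ↔ x ∈ D := by
      intro m
      induction m with
      | zero => exact fun _ x => Iff.rfl
      | succ m ihm =>
        intro hm x
        rw [compUpTo, Function.comp_apply, ihm (Nat.le_of_succ_le hm), ih m hm]
    have key : ∀ y, y ∉ B (n + 1) → (σ n y ∈ D ↔ y ∈ D) := by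
      intro y hy
      rw [← hD y ⟨n + 1, hy⟩, h.foldLimit_eq hy, compUpTo, Function.comp_apply, hcomp n le_rfl]
    by_cases hx : x ∈ B (n + 1)
    · by_cases hfix : σ n x = x
      · rw [hfix]
      · rw [← key _ ((h.isFold n).notMem_of_mem x hx hfix), (h.isFold n).involutive x]
    · exact key x hx

/-- The set where the limit of the compositions or of their inverses fails to exist. -/
def foldBad {X : Type*} (B : ℕ → Set X) (σ : ℕ → X → X) : Set X :=
  (⋂ n, B n) ∪ ⋂ n, compDownFrom σ n ⁻¹' B n

variable [Countable G] [StandardBorelSpace X]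

theorem IsFoldSequence.measure_foldBad (hmeas : ∀ g : G, Measurable (fun x : X => g • x))
    (haper : ∀ x : X, (MulAction.orbit G x).Infinite) (h : IsFoldSequence G A B σ f)
    {ν : Measure X} [IsProbabilityMeasure ν]
    (hν : ∀ g : G, MeasurePreserving (fun x : X => g • x) ν ν) : ν (foldBad B σ) = 0 := by
  have hreal : ∀ n, ν.real (B n) = (1 / 2) ^ n := by
    intro n
    induction n with
    | zero => simp [h.base]
    | succ n ih =>
      have h1 := (h.isFold n).setIntegral_add_comp hmeas haper hν (h.measurableSet n)
        (h.eq_of_fixed n) (integrable_const (1 : ℝ))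
      simp only [setIntegral_const, smul_eq_mul, mul_one] at h1
      rw [pow_succ, ← ih, ← h1]
      ring
  have hpres : ∀ n, MeasurePreserving (compDownFrom σ n) ν ν := by
    intro n
    induction n with
    | zero => exact MeasurePreserving.id ν
    | succ n ih => exact ((h.isFold n).measurePreserving hmeas hν).comp ih
  have hzero : ∀ s : Set X, (∀ n, ν.real s ≤ (1 / 2) ^ n) → ν s = 0 := by
    intro s hs
    rw [← measureReal_eq_zero_iff]
    refine le_antisymm (ge_of_tendsto' (tendsto_pow_atTop_nhds_zero_of_lt_one ?_ ?_) hs)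
      measureReal_nonneg <;> norm_num
  refine measure_union_null (hzero _ fun n => ?_) (hzero _ fun n => ?_)
  · exact hreal n ▸ measureReal_mono (Set.iInter_subset _ n)
  · refine (measureReal_mono (Set.iInter_subset _ n)).trans ?_
    rw [(hpres n).measureReal_preimage (h.measurableSet n).nullMeasurableSet, hreal]

/-- A standard Borel space carries a sequence of Borel sets that is dense for every finite
measure. -/
theorem exists_seq_measureDense (X : Type*) [MeasurableSpace X] [StandardBorelSpace X] :
    ∃ A : ℕ → Set X, (∀ k, MeasurableSet (A k)) ∧ ∀ (ν : Measure X) [IsFiniteMeasure ν]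
      (D : Set X), MeasurableSet D → ∀ ε : ℝ, 0 < ε → ∃ k, ν.real (symmDiff D (A k)) < ε := by
  set 𝒜 := generateSetAlgebra (MeasurableSpace.countableGeneratingSet X) with h𝒜
  have hdense : ∀ (ν : Measure X) [IsFiniteMeasure ν], ν.MeasureDense 𝒜 := fun ν _ =>
    Measure.MeasureDense.of_generateFrom_isSetAlgebra_finite ν isSetAlgebra_generateSetAlgebra
      (by rw [generateFrom_generateSetAlgebra_eq,
        MeasurableSpace.generateFrom_countableGeneratingSet])
  obtain ⟨A, hA⟩ := (countable_generateSetAlgebra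
    (MeasurableSpace.countable_countableGeneratingSet (α := X))).exists_eq_range
    (hdense 0).nonempty
  have hmem : ∀ k, A k ∈ 𝒜 := fun k => by rw [h𝒜, hA]; exact Set.mem_range_self k
  refine ⟨A, fun k => (hdense 0).measurable _ (hmem k), fun ν _ D hD ε hε => ?_⟩
  obtain ⟨t, ht, hlt⟩ := (hdense ν).approx D hD (measure_ne_top _ _) ε hε
  rw [h𝒜, hA] at ht
  obtain ⟨k, rfl⟩ := ht
  exact ⟨k, (ENNReal.lt_ofReal_iff_toReal_lt (measure_ne_top _ _)).1 hlt⟩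

end

/-- For every aperiodic Borel action `G ↷ X` of a countable group on a standard Borel space
there is an element `S` of the full group `[E_G^X]` (a Borel bijection moving points within
their `G`-orbits) such that every `G`-invariant ergodic Borel probability measure is
`S`-invariant and `S`-ergodic. -/
theorem exists_full_group_element_ergodic_for_all
    {G X : Type*} [Group G] [Countable G] [MeasurableSpace X] [StandardBorelSpace X]
    [MulAction G X]
    (hmeas : ∀ g : G, Measurable (fun x : X => g • x))
    (haper : ∀ x : X, (MulAction.orbit G x).Infinite) :
    ∃ S : X ≃ X, Measurable S ∧ Measurable S.symm ∧
      (∀ x : X, S x ∈ MulAction.orbit G x) ∧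
      ∀ ν : Measure X, IsErgodicInvariant G ν →
        MeasurePreserving S ν ν ∧
        ∀ s : Set X, MeasurableSet s → S ⁻¹' s = s → ν s = 0 ∨ ν s = 1 := by
  classical
  obtain ⟨A, hA, hdense⟩ := exists_seq_measureDense X
  obtain ⟨B, σ, f, h⟩ := exists_isFoldSequence hmeas hA
  set K : Set X := {x | ∀ g : G, g • x ∉ foldBad B σ} with hK
  have hbad : MeasurableSet (foldBad B σ) :=
    (MeasurableSet.iInter h.measurableSet).union
      (MeasurableSet.iInter fun n => h.measurable_compDownFrom n (h.measurableSet n))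
  have hKeq : K = ⋂ g : G, ((fun x : X => g • x) ⁻¹' foldBad B σ)ᶜ := by
    ext x
    simp [hK]
  have hKm : MeasurableSet K := by
    rw [hKeq]
    exact MeasurableSet.iInter fun g => (hmeas g hbad).compl
  have hKorb : ∀ x, ∀ y ∈ MulAction.orbit G x, x ∈ K → y ∈ K := by
    rintro x _ ⟨a, rfl⟩ hx g
    simpa only [mul_smul] using hx (g * a)
  have hKiff : ∀ x, ∀ y ∈ MulAction.orbit G x, (y ∈ K ↔ x ∈ K) := fun x y hy =>
    ⟨hKorb y x (MulAction.mem_orbit_symm.1 hy), hKorb x y hy⟩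
  have hKnot : ∀ x ∈ K, x ∉ foldBad B σ := fun x hx => by simpa using hx 1
  have hKex : ∀ x ∈ K, ∃ n, x ∉ B n := fun x hx => by
    by_contra! hcon
    exact hKnot x hx (Or.inl (Set.mem_iInter.2 hcon))
  set T : X → X := fun x => if x ∈ K then foldLimit B σ x else x with hT
  have hTK : ∀ x ∈ K, T x = foldLimit B σ x := fun x hx => if_pos hx
  have hTnK : ∀ x, x ∉ K → T x = x := fun x hx => if_neg hx
  have hTm : Measurable T := Measurable.ite hKm h.measurable_foldLimit measurable_id
  have hTorb : ∀ x, T x ∈ MulAction.orbit G x := by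
    intro x
    by_cases hx : x ∈ K
    · rw [hTK x hx]
      exact h.foldLimit_mem_orbit x
    · rw [hTnK x hx]
      exact MulAction.mem_orbit_self x
  have hinj : Function.Injective T := by
    intro x y hxy
    have hiff : x ∈ K ↔ y ∈ K := by
      rw [← hKiff x _ (hTorb x), hxy, hKiff y _ (hTorb y)]
    by_cases hx : x ∈ K
    · have hy := hiff.1 hx
      rw [hTK x hx, hTK y hy] at hxy
      exact h.foldLimit_injOn (hKex x hx) (hKex y hy) hxy
    · rwa [hTnK x hx, hTnK y fun hy => hx (hiff.2 hy)] at hxy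
  have hsurj : Function.Surjective T := by
    intro z
    by_cases hz : z ∈ K
    · obtain ⟨n, hn⟩ : ∃ n, compDownFrom σ n z ∉ B n := by
        by_contra! hcon
        exact hKnot z hz (Or.inr (Set.mem_iInter.2 hcon))
      refine ⟨compDownFrom σ n z, ?_⟩
      rw [hTK _ (hKorb z _ (h.compDownFrom_mem_orbit n z) hz), h.foldLimit_eq hn,
        h.compUpTo_compDownFrom]
    · exact ⟨z, hTnK z hz⟩
  refine ⟨Equiv.ofBijective T ⟨hinj, hsurj⟩, hTm, ?_, hTorb, fun ν hν => ⟨?_, ?_⟩⟩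
  · intro s hs
    rw [← Equiv.image_eq_preimage_symm]
    exact (hTm.measurableEmbedding hinj).measurableSet_image.2 hs
  · exact measurePreserving_of_mem_orbit hmeas hν.2.1 hTm ⟨hinj, hsurj⟩ hTorb
  · intro s hs hsT
    have hprob := hν.1
    have hνK : ν Kᶜ = 0 := by
      rw [hKeq, Set.compl_iInter]
      refine measure_iUnion_null fun g => ?_
      rw [compl_compl, (hν.2.1 g).measure_preimage hbad.nullMeasurableSet]
      exact h.measure_foldBad hmeas haper hν.2.1
    have hsK : ν (s ∩ K) = ν s := measure_inter_conull hνK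
    have hsT' : ∀ x, T x ∈ s ↔ x ∈ s := fun x => Set.ext_iff.1 hsT x
    rw [← hsK]
    refine h.measure_eq_zero_or_one hmeas haper hν (hs.inter hKm)
      (h.mem_iff_of_foldLimit fun x _ => ?_)
      (fun ε hε => hdense ν _ (hs.inter hKm) ε hε) hA
    simp only [Set.mem_inter_iff, hKiff x _ (h.foldLimit_mem_orbit x)]
    refine and_congr_left fun hx => ?_
    rw [← hTK x hx, hsT']
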